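/- In a Galton–Watson tree with offspring distribution p = (p_1, …, p_M) (no extinction, all p supported on ≥1 children), modifying the root's offspring distribution to P(c(o) = k+1) = p_k makes the resulting random rooted tree stationary: the distribution of the rooted tree is invariant under re-rooting at a uniformly random neighbour of the root. -/

import Mathlib

open MeasureTheory Filter Topology

/-- Encoding of infinite leafless rooted trees: `f : List ℕ → ℕ` assigns to the
vertex reached from the root by the sequence of child-indices `w` its number of
children `f w` (for the root, `f []` is its number of neighbours). -/
abbrev TreeCode : Type := List ℕ → ℕ

/-- Re-rooting the tree coded by `f` at the `i`-th child of the root.  The new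
root keeps its `f [i]` children (indices `< f [i]`) and acquires the old root
as an extra neighbour (index `f [i]`); on the old-root side the branch `i` is
removed and the remaining children of the old root are relabelled. -/
def reRoot (i : ℕ) (f : TreeCode) : TreeCode
  | [] => f [i] + 1
  | j :: q =>
    if j < f [i] then f (i :: j :: q)
    else if j = f [i] then
      match q with
      | [] => f [] - 1
      | j' :: q' => f ((if j' < i then j' else j' + 1) :: q')
    else 0

/-- The law of one step of the simple random walk from the root: re-root at a
uniformly random neighbour of the root. -/
noncomputable def uniformReRoot (f : TreeCode) : Measure TreeCode :=
  ((f [] : ENNReal))⁻¹ • ∑ i ∈ Finset.range (f []), Measure.dirac (reRoot i f)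

/-- `w` is a valid vertex of the tree coded by `f`: each child index along the
path is smaller than the children count of its parent. -/
def IsValidNode (f : TreeCode) (w : List ℕ) : Prop :=
  ∀ (n : ℕ) (h : n < w.length), w.get ⟨n, h⟩ < f (w.take n)

/-- The trees that agree with `g` on the finite set of words `s`. -/
def treeCylinder (s : Finset (List ℕ)) (g : TreeCode) : Set TreeCode :=
  {f | ∀ w ∈ s, f w = g w}

/-- `s` is a finite subtree of the tree coded by `g`, containing the root and the last neighbour
of the root. -/
structure IsSubtreeRegion (s : Finset (List ℕ)) (g : TreeCode) : Prop where
  nil_mem : [] ∈ s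
  root_ne_zero : g [] ≠ 0
  last_mem : [g [] - 1] ∈ s
  parent : ∀ (w : List ℕ) (a : ℕ), w ++ [a] ∈ s → w ∈ s ∧ a < g w

/-- The cylinders over finite subtrees containing the last neighbour of the root. -/
def regionCylinders : Set (Set TreeCode) :=
  {c | ∃ s g, IsSubtreeRegion s g ∧ c = treeCylinder s g}

/-- Words which are vertices of the tree coded by `f`, expressed through prefixes. -/
def PrefixValid (f : TreeCode) (w : List ℕ) : Prop :=
  f [] ≠ 0 ∧ ∀ (u : List ℕ) (a : ℕ), u ++ [a] <+: w → a < f u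

/-- Tree codes with a neighbour at the root, vanishing outside of the tree they code. -/
def properTrees : Set TreeCode :=
  {f | f [] ≠ 0 ∧ ∀ (w : List ℕ) (a : ℕ), f (w ++ [a]) ≠ 0 → a < f w}

open Classical in
/-- Replace the values outside of the coded tree by zero. -/
noncomputable def pruneTree (f : TreeCode) : TreeCode :=
  fun w => if PrefixValid f w then f w else 0

lemma IsSubtreeRegion.congr {s : Finset (List ℕ)} {g f : TreeCode} (h : IsSubtreeRegion s g)
    (hf : f ∈ treeCylinder s g) : IsSubtreeRegion s f := by
  have h0 := hf _ h.nil_mem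
  refine ⟨h.nil_mem, by rw [h0]; exact h.root_ne_zero, by rw [h0]; exact h.last_mem, ?_⟩
  intro w a hw
  obtain ⟨h1, h2⟩ := h.parent w a hw
  exact ⟨h1, by rw [hf w h1]; exact h2⟩

lemma treeCylinder_congr {s : Finset (List ℕ)} {g f : TreeCode}
    (hf : f ∈ treeCylinder s g) : treeCylinder s g = treeCylinder s f := by
  ext h
  exact forall₂_congr fun w hw => by rw [hf w hw]

lemma measurableSet_treeCylinder (s : Finset (List ℕ)) (g : TreeCode) :
    MeasurableSet (treeCylinder s g) := by
  have : treeCylinder s g = ⋂ w ∈ s, (fun f : TreeCode => f w) ⁻¹' {g w} := by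
    ext f; simp [treeCylinder]
  rw [this]
  exact Finset.measurableSet_biInter _ fun w _ =>
    (measurable_pi_apply w) (measurableSet_singleton _)

lemma isPiSystem_regionCylinders : IsPiSystem regionCylinders := by
  rintro _ ⟨s, g, hs, rfl⟩ _ ⟨t, h, ht, rfl⟩ ⟨f, hf, hf'⟩
  have hs' := hs.congr hf
  have ht' := ht.congr hf'
  rw [treeCylinder_congr hf, treeCylinder_congr hf']
  refine ⟨s ∪ t, f, ⟨?_, hs'.root_ne_zero, ?_, ?_⟩, ?_⟩
  · exact Finset.mem_union_left _ hs'.nil_mem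
  · exact Finset.mem_union_left _ hs'.last_mem
  · intro w a hw
    rcases Finset.mem_union.1 hw with hw | hw
    · exact ⟨Finset.mem_union_left _ (hs'.parent w a hw).1, (hs'.parent w a hw).2⟩
    · exact ⟨Finset.mem_union_right _ (ht'.parent w a hw).1, (ht'.parent w a hw).2⟩
  · ext k
    simp only [treeCylinder, Set.mem_inter_iff, Set.mem_ofPred_eq, Finset.mem_union]
    constructor
    · rintro ⟨h1, h2⟩ w (hw | hw)
      exacts [h1 w hw, h2 w hw]
    · exact fun h1 => ⟨fun w hw => h1 w (Or.inl hw), fun w hw => h1 w (Or.inr hw)⟩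

lemma countable_regionCylinders : regionCylinders.Countable := by
  refine (Set.countable_range fun x : Finset (List ℕ) × (List ℕ →₀ ℕ) =>
    treeCylinder x.1 x.2).mono ?_
  rintro _ ⟨s, g, -, rfl⟩
  refine ⟨(s, Finsupp.indicator s fun w _ => g w), ?_⟩
  ext f
  refine forall₂_congr fun w hw => ?_
  simp [hw]

lemma measurableSet_of_forall_region {D : Set TreeCode}
    (hD : ∀ f ∈ D, ∃ s, IsSubtreeRegion s f ∧ treeCylinder s f ⊆ D) :
    MeasurableSet[MeasurableSpace.generateFrom regionCylinders] D := by
  have : D = ⋃₀ {c ∈ regionCylinders | c ⊆ D} := by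
    apply subset_antisymm
    · intro f hf
      obtain ⟨s, hs, hsD⟩ := hD f hf
      exact ⟨treeCylinder s f, ⟨⟨s, f, hs, rfl⟩, hsD⟩, fun _ _ => rfl⟩
    · exact Set.sUnion_subset fun c hc => hc.2
  rw [this]
  exact MeasurableSet.sUnion (countable_regionCylinders.mono fun c hc => hc.1)
    fun c hc => MeasurableSpace.measurableSet_generateFrom hc.1

lemma measurable_pruneTree :
    Measurable[MeasurableSpace.generateFrom regionCylinders] pruneTree := by
  refine @measurable_pi_lambda _ _ _ (MeasurableSpace.generateFrom regionCylinders) _ _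
    fun w => ?_
  refine @measurable_of_Ioi ℕ TreeCode _ _ _ (MeasurableSpace.generateFrom regionCylinders) _ _ _ _
    fun n => ?_
  have : (fun f => pruneTree f w) ⁻¹' Set.Ioi n = {f | PrefixValid f w ∧ n < f w} := by
    ext f
    by_cases h : PrefixValid f w <;> simp [pruneTree, h]
  rw [this]
  apply measurableSet_of_forall_region
  rintro f ⟨⟨h0, hv⟩, hn⟩
  have hmem : ∀ u, u <+: w → u ∈ insert [f [] - 1] w.inits.toFinset := by
    intro u hu; simp [hu]
  refine ⟨insert [f [] - 1] w.inits.toFinset, ⟨hmem [] ⟨w, rfl⟩, h0, by simp, ?_⟩, ?_⟩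
  · intro u a hu
    simp only [Finset.mem_insert, List.mem_toFinset, List.mem_inits] at hu
    rcases hu with hu | hu
    · obtain ⟨rfl, ha⟩ : u = [] ∧ a = f [] - 1 := by
        cases u <;> simp_all
      exact ⟨hmem [] ⟨w, rfl⟩, by omega⟩
    · exact ⟨hmem _ ((List.prefix_append _ _).trans hu), hv u a hu⟩
  · intro h hh
    refine ⟨⟨?_, ?_⟩, ?_⟩
    · rw [hh _ (hmem [] ⟨w, rfl⟩)]; exact h0
    · intro u a hu
      rw [hh _ (hmem _ ((List.prefix_append _ _).trans hu))]
      exact hv u a hu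
    · rw [hh _ (hmem _ List.prefix_rfl)]; exact hn

lemma pruneTree_eq_self {f : TreeCode} (hf : f ∈ properTrees) : pruneTree f = f := by
  funext w
  have key : ∀ w : List ℕ, f w ≠ 0 → ∀ u a, u ++ [a] <+: w → a < f u := by
    intro w
    induction w using List.reverseRecOn with
    | nil => intro _ u a h; simp at h
    | append_singleton w b ih =>
      intro hw u a h
      have hb := hf.2 w b hw
      rcases List.prefix_concat_iff.1 h with h | h
      · obtain ⟨rfl, h2⟩ := List.append_inj' h rfl
        simp only [List.cons.injEq, and_true] at h2
        rw [h2]; exact hb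
      · exact ih (by omega) u a h
  by_cases h : f w = 0
  · simp [pruneTree, h]
  · exact if_pos ⟨hf.1, key w h⟩

lemma measurableSet_properTrees : MeasurableSet properTrees := by
  have : properTrees = {f : TreeCode | f [] = 0}ᶜ ∩
      ⋂ (w : List ℕ) (a : ℕ), ({f : TreeCode | f (w ++ [a]) = 0} ∪ {f | a < f w}) := by
    ext f
    simp [properTrees, or_iff_not_imp_left]
  rw [this]
  refine ((measurable_pi_apply _) (measurableSet_singleton 0)).compl.inter
    (MeasurableSet.iInter fun w => MeasurableSet.iInter fun a => MeasurableSet.union ?_ ?_)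
  · exact (measurable_pi_apply (w ++ [a])) (measurableSet_singleton 0)
  · exact (measurable_pi_apply w) (measurableSet_Ioi (a := a))

/-- A finite measure on proper trees is determined by its values on cylinders over finite
subtrees. -/
lemma treeMeasure_ext {μ ν : Measure TreeCode} [IsFiniteMeasure μ]
    (hμ : ∀ᵐ f ∂μ, f ∈ properTrees) (hν : ∀ᵐ f ∂ν, f ∈ properTrees)
    (huniv : μ Set.univ = ν Set.univ)
    (h : ∀ s g, IsSubtreeRegion s g → μ (treeCylinder s g) = ν (treeCylinder s g)) :
    μ = ν := by
  have hle : MeasurableSpace.generateFrom regionCylinders ≤ MeasurableSpace.pi := by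
    refine MeasurableSpace.generateFrom_le ?_
    rintro _ ⟨s, g, -, rfl⟩
    exact measurableSet_treeCylinder s g
  have htrim : μ.trim hle = ν.trim hle := by
    refine @ext_of_generate_finite _ (MeasurableSpace.generateFrom regionCylinders) _ _
      regionCylinders rfl isPiSystem_regionCylinders (isFiniteMeasure_trim hle) ?_ ?_
    · rintro c hc
      rw [trim_measurableSet_eq hle (MeasurableSpace.measurableSet_generateFrom hc),
        trim_measurableSet_eq hle (MeasurableSpace.measurableSet_generateFrom hc)]
      obtain ⟨s, g, hs, rfl⟩ := hc
      exact h s g hs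
    · rw [trim_measurableSet_eq hle MeasurableSet.univ,
        trim_measurableSet_eq hle MeasurableSet.univ, huniv]
  ext A hA
  have hB := measurable_pruneTree hA
  have aux : ∀ ρ : Measure TreeCode, (∀ᵐ f ∂ρ, f ∈ properTrees) →
      ρ A = ρ (pruneTree ⁻¹' A) := by
    intro ρ hρ
    refine measure_congr ?_
    filter_upwards [hρ] with f hf
    exact congrArg A (pruneTree_eq_self hf).symm
  rw [aux μ hμ, aux ν hν, ← trim_measurableSet_eq hle hB, ← trim_measurableSet_eq hle hB, htrim]

lemma measurable_reRoot (i : ℕ) : Measurable (reRoot i) := by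
  refine measurable_pi_lambda _ fun w => ?_
  have hlt : ∀ j : ℕ, MeasurableSet {f : TreeCode | j < f [i]} := fun j =>
    (measurable_pi_apply [i]) (measurableSet_Ioi (a := j))
  have heq : ∀ j : ℕ, MeasurableSet {f : TreeCode | j = f [i]} := fun j => by
    simpa [Set.preimage, eq_comm] using
      (measurable_pi_apply (X := fun _ : List ℕ => ℕ) [i]) (measurableSet_singleton j)
  have hsub : ∀ (u : List ℕ) (φ : ℕ → ℕ), Measurable fun f : TreeCode => φ (f u) := fun u φ =>
    (measurable_of_countable φ).comp (measurable_pi_apply u)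
  match w with
  | [] => exact hsub [i] (· + 1)
  | [j] =>
    exact Measurable.ite (hlt j) (measurable_pi_apply _)
      (Measurable.ite (heq j) (hsub [] (· - 1)) measurable_const)
  | j :: j' :: q =>
    exact Measurable.ite (hlt j) (measurable_pi_apply _)
      (Measurable.ite (heq j) (measurable_pi_apply _) measurable_const)

lemma uniformReRoot_apply (f : TreeCode) {A : Set TreeCode} (hA : MeasurableSet A) :
    uniformReRoot f A =
      (f [] : ENNReal)⁻¹ * ∑ i ∈ Finset.range (f []), A.indicator 1 (reRoot i f) := by
  simp [uniformReRoot, Measure.finsetSum_apply, Measure.dirac_apply' _ hA]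

lemma measurable_apply_root {F : ℕ → TreeCode → ENNReal} (hF : ∀ n, Measurable (F n)) :
    Measurable fun f : TreeCode => F (f []) f := by
  have h : Measurable fun x : ℕ × TreeCode => F x.1 x.2 :=
    measurable_from_prod_countable_right hF
  have hpair : Measurable fun f : TreeCode => (f [], f) :=
    (measurable_pi_apply []).prodMk measurable_id
  exact h.comp hpair

lemma measurable_uniformReRoot : Measurable uniformReRoot := by
  refine Measure.measurable_of_measurable_coe _ fun A hA => ?_
  simp_rw [uniformReRoot_apply _ hA]
  have hind : Measurable (A.indicator (1 : TreeCode → ENNReal)) := measurable_one.indicator hA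
  refine measurable_apply_root (F := fun n f => (n : ENNReal)⁻¹ *
    ∑ i ∈ Finset.range n, A.indicator (1 : TreeCode → ENNReal) (reRoot i f)) fun n => ?_
  have hsum : Measurable fun f : TreeCode =>
      ∑ i ∈ Finset.range n, A.indicator (1 : TreeCode → ENNReal) (reRoot i f) :=
    Finset.measurable_sum _ fun i _ => hind.comp (measurable_reRoot i)
  exact hsum.const_mul (n : ENNReal)⁻¹

lemma reRoot_mem_properTrees {f : TreeCode} (hf : f ∈ properTrees) {i : ℕ} (hi : i < f []) :
    reRoot i f ∈ properTrees := by
  refine ⟨by simp [reRoot], ?_⟩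
  intro w a
  match w with
  | [] =>
    simp only [List.nil_append, reRoot]
    split_ifs <;> intro h <;> omega
  | [j] =>
    simp only [List.cons_append, List.nil_append, reRoot]
    split_ifs with h1 h2 h3
    · exact hf.2 [i, j] a
    · intro _; omega
    · intro h
      have := hf.2 [] (a + 1) h
      omega
    · simp
  | j :: j' :: q =>
    simp only [List.cons_append, reRoot]
    split_ifs with h1 h2 h3
    · exact hf.2 (i :: j :: j' :: q) a
    · exact hf.2 (j' :: q) a
    · exact hf.2 ((j' + 1) :: q) a
    · simp

/-- The word naming, in a tree, the vertex called `w` once the tree is re-rooted at the child `i`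
of its root; `m` is the number of children of that child. -/
def unrootWord (m i : ℕ) : List ℕ → List ℕ
  | [] => [i]
  | j :: q =>
    if j < m then i :: j :: q
    else match q with
      | [] => []
      | j' :: q' => (if j' < i then j' else j' + 1) :: q'

/-- A left inverse of `unrootWord m i` on words starting with a letter at most `m`. -/
def rerootWord (m i : ℕ) : List ℕ → List ℕ
  | [] => [m]
  | a :: q => if a = i then q else m :: (if a < i then a else a - 1) :: q

lemma rerootWord_unrootWord (m i : ℕ) {w : List ℕ} (hw : ∀ j q, w = j :: q → j ≤ m) :
    rerootWord m i (unrootWord m i w) = w := by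
  match w with
  | [] => simp [unrootWord, rerootWord]
  | [j] =>
    have := hw j _ rfl
    by_cases h : j < m
    · simp [unrootWord, rerootWord, h]
    · simp only [unrootWord, rerootWord, h, if_false]
      rw [show j = m by omega]
  | j :: j' :: q =>
    have := hw j _ rfl
    by_cases h : j < m
    · simp [unrootWord, rerootWord, h]
    · obtain rfl : j = m := by omega
      by_cases h' : j' < i
      · simp [unrootWord, rerootWord, h', h'.ne]
      · have h1 : j' + 1 ≠ i := by omega
        have h2 : ¬ j' + 1 < i := by omega
        simp [unrootWord, rerootWord, h', h1, h2]

/-- The children counts prescribed by `g` after re-rooting at `i`, read in the original tree. -/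
def unrootTree (i : ℕ) (g : TreeCode) : TreeCode := fun w =>
  if w = [] then g [g [] - 1] + 1
  else if w = [i] then g [] - 1
  else g (rerootWord (g [] - 1) i w)

lemma IsSubtreeRegion.head_le {s : Finset (List ℕ)} {g : TreeCode} (hs : IsSubtreeRegion s g)
    {w : List ℕ} (hw : w ∈ s) (j : ℕ) (q : List ℕ) (h : w = j :: q) : j ≤ g [] - 1 := by
  subst h
  induction q using List.reverseRecOn with
  | nil => have := (hs.parent [] j hw).2; omega
  | append_singleton q a ih => exact ih (hs.parent (j :: q) a hw).1

lemma unrootTree_unrootWord {s : Finset (List ℕ)} {g : TreeCode} (hs : IsSubtreeRegion s g)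
    (i : ℕ) {w : List ℕ} (hw : w ∈ s) (h0 : w ≠ []) (h1 : w ≠ [g [] - 1]) :
    unrootTree i g (unrootWord (g [] - 1) i w) = g w := by
  have hinv := fun w hw => rerootWord_unrootWord (g [] - 1) i (w := w) (hs.head_le hw)
  have e1 : unrootWord (g [] - 1) i w ≠ [] := by
    intro h
    have h2 := hinv w hw
    rw [h] at h2
    exact h1 h2.symm
  have e2 : unrootWord (g [] - 1) i w ≠ [i] := by
    intro h
    have h2 := hinv w hw
    rw [h] at h2
    exact h0 (by rw [← h2]; simp [rerootWord])
  rw [unrootTree, if_neg e1, if_neg e2, hinv w hw]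

lemma IsSubtreeRegion.unroot_parent {s : Finset (List ℕ)} {g : TreeCode}
    (hs : IsSubtreeRegion s g) {i : ℕ} (hi : i < g [g [] - 1] + 1) (w : List ℕ) (a : ℕ)
    (hw : w ++ [a] ∈ s.image (unrootWord (g [] - 1) i)) :
    w ∈ s.image (unrootWord (g [] - 1) i) ∧ a < unrootTree i g w := by
  obtain ⟨u, hu, huw⟩ := Finset.mem_image.1 hw
  have hnil : [] ∈ s.image (unrootWord (g [] - 1) i) :=
    Finset.mem_image.2 ⟨_, hs.last_mem, by simp [unrootWord]⟩
  have step : ∀ v, v ∈ s → v ≠ [] → v ≠ [g [] - 1] → unrootWord (g [] - 1) i v = w →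
      a < g v → w ∈ s.image (unrootWord (g [] - 1) i) ∧ a < unrootTree i g w := by
    rintro v hv h0 h1 rfl ha
    exact ⟨Finset.mem_image_of_mem _ hv, by rwa [unrootTree_unrootWord hs i hv h0 h1]⟩
  match u with
  | [] =>
    obtain ⟨rfl, rfl⟩ : w = [] ∧ a = i := by
      cases w <;> simp_all [unrootWord]
    exact ⟨hnil, by simpa [unrootTree] using hi⟩
  | j :: q =>
    have hj := hs.head_le hu j q rfl
    by_cases h : j < g [] - 1
    · simp only [unrootWord, h, if_true] at huw
      rcases List.eq_nil_or_concat q with rfl | ⟨q, b, rfl⟩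
      · obtain ⟨rfl, h2⟩ := List.append_inj' (s₁ := [i]) (t₁ := [j]) huw rfl
        obtain rfl : j = a := by simpa using h2
        exact ⟨Finset.mem_image.2 ⟨_, hs.nil_mem, by simp [unrootWord]⟩, by simpa [unrootTree]⟩
      · obtain ⟨rfl, h2⟩ := List.append_inj' (s₁ := i :: j :: q) (t₁ := [b]) (t₂ := [a])
          (by simpa only [List.concat_eq_append, List.cons_append] using huw) rfl
        obtain rfl : b = a := by simpa using h2
        have := hs.parent (j :: q) b (by simpa using hu)
        refine step _ this.1 (by simp) ?_ (by simp [unrootWord, h]) this.2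
        intro h'
        simp only [List.cons.injEq] at h'
        omega
    · obtain rfl : j = g [] - 1 := by omega
      match q with
      | [] => simp [unrootWord] at huw
      | j' :: q =>
        simp only [unrootWord, lt_irrefl, if_false] at huw
        rcases List.eq_nil_or_concat q with rfl | ⟨q, b, rfl⟩
        · obtain ⟨rfl, h2⟩ := List.append_inj' (s₁ := []) (t₁ := [_]) huw rfl
          simp only [List.cons.injEq, and_true] at h2
          have := (hs.parent [g [] - 1] j' hu).2
          refine ⟨hnil, ?_⟩
          simp only [unrootTree, if_true]
          split_ifs at h2 <;> omega
        · obtain ⟨rfl, h2⟩ := List.append_inj' (t₁ := [b]) (t₂ := [a])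
            (s₁ := (if j' < i then j' else j' + 1) :: q)
            (by simpa only [List.concat_eq_append, List.cons_append] using huw) rfl
          obtain rfl : b = a := by simpa using h2
          have := hs.parent ((g [] - 1) :: j' :: q) b (by simpa using hu)
          exact step _ this.1 (by simp) (by simp) (by simp [unrootWord]) this.2

lemma reRoot_eq_unrootWord {f : TreeCode} {m i : ℕ} (hm : f [i] = m) {w : List ℕ}
    (hw : ∀ j q, w = j :: q → j ≤ m) (h0 : w ≠ []) (h1 : w ≠ [m]) :
    reRoot i f w = f (unrootWord m i w) := by
  subst hm
  match w with
  | [] => exact absurd rfl h0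
  | j :: q =>
    have hj := hw j q rfl
    by_cases h : j < f [i]
    · cases q <;> simp [reRoot, unrootWord, h]
    · obtain rfl : j = f [i] := by omega
      cases q with
      | nil => exact absurd rfl h1
      | cons j' q => simp [reRoot, unrootWord]

lemma reRoot_mem_treeCylinder_iff {s : Finset (List ℕ)} {g : TreeCode}
    (hs : IsSubtreeRegion s g) {f : TreeCode} {i : ℕ} (hi : i < f []) :
    reRoot i f ∈ treeCylinder s g ↔
      f ∈ treeCylinder (s.image (unrootWord (g [] - 1) i)) (unrootTree i g) := by
  have hg := hs.root_ne_zero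
  have key : ∀ w ∈ s, f [i] = g [] - 1 →
      (reRoot i f w = g w ↔
        f (unrootWord (g [] - 1) i w) = unrootTree i g (unrootWord (g [] - 1) i w)) := by
    intro w hw hm
    by_cases h0 : w = []
    · subst h0
      simp only [reRoot, unrootWord, unrootTree]
      simp
      omega
    by_cases h1 : w = [g [] - 1]
    · subst h1
      simp only [reRoot, unrootWord, unrootTree, hm]
      simp
      omega
    rw [unrootTree_unrootWord hs i hw h0 h1, reRoot_eq_unrootWord hm (hs.head_le hw) h0 h1]
  simp only [treeCylinder, Set.mem_ofPred_eq, Finset.forall_mem_image]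
  constructor
  · intro h
    have hm : f [i] = g [] - 1 := by
      have := h _ hs.nil_mem
      simp only [reRoot] at this
      omega
    exact fun w hw => (key w hw hm).1 (h w hw)
  · intro h
    have hm : f [i] = g [] - 1 := by
      simpa [unrootWord, unrootTree] using h hs.nil_mem
    exact fun w hw => (key w hw hm).2 (h hw)

lemma uniformReRoot_treeCylinder {s : Finset (List ℕ)} {g : TreeCode}
    (hs : IsSubtreeRegion s g) (f : TreeCode) :
    uniformReRoot f (treeCylinder s g) =
      ((g [g [] - 1] + 1 : ℕ) : ENNReal)⁻¹ * ∑ i ∈ Finset.range (g [g [] - 1] + 1),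
        (treeCylinder (s.image (unrootWord (g [] - 1) i)) (unrootTree i g)).indicator 1 f := by
  rw [uniformReRoot_apply f (measurableSet_treeCylinder s g)]
  have hroot : ∀ i, f ∈ treeCylinder (s.image (unrootWord (g [] - 1) i)) (unrootTree i g) →
      f [] = g [g [] - 1] + 1 := by
    intro i h
    simpa [unrootTree] using
      h [] (Finset.mem_image.2 ⟨_, hs.last_mem, by simp [unrootWord]⟩)
  have hsum : ∀ i ∈ Finset.range (f []), (treeCylinder s g).indicator (1 : TreeCode → ENNReal)
      (reRoot i f) =
      (treeCylinder (s.image (unrootWord (g [] - 1) i)) (unrootTree i g)).indicator 1 f := by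
    intro i hi
    have := reRoot_mem_treeCylinder_iff hs (Finset.mem_range.1 hi)
    by_cases h : reRoot i f ∈ treeCylinder s g
    · rw [Set.indicator_of_mem h, Set.indicator_of_mem (this.1 h)]; rfl
    · rw [Set.indicator_of_notMem h, Set.indicator_of_notMem (mt this.2 h)]
  rw [Finset.sum_congr rfl hsum]
  by_cases h : f [] = g [g [] - 1] + 1
  · rw [h]
  · have : ∀ i, (treeCylinder (s.image (unrootWord (g [] - 1) i)) (unrootTree i g)).indicator
        (1 : TreeCode → ENNReal) f = 0 := fun i => Set.indicator_of_notMem (mt (hroot i) h) _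
    simp [this]

lemma prod_unrootTree {s : Finset (List ℕ)} {g : TreeCode} (hs : IsSubtreeRegion s g) (i : ℕ)
    (p : ℕ → ENNReal) :
    p (unrootTree i g [] - 1) *
        ∏ w ∈ (s.image (unrootWord (g [] - 1) i)).erase [], p (unrootTree i g w) =
      p (g [] - 1) * ∏ w ∈ s.erase [], p (g w) := by
  have hinv := fun w hw => rerootWord_unrootWord (g [] - 1) i (w := w) (hs.head_le hw)
  have hinj : Set.InjOn (unrootWord (g [] - 1) i) s := fun w hw v hv h => by
    rw [← hinv w hw, h, hinv v hv]
  have himg : (s.image (unrootWord (g [] - 1) i)).erase [] =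
      (s.erase [g [] - 1]).image (unrootWord (g [] - 1) i) := by
    have : unrootWord (g [] - 1) i [g [] - 1] = [] := by simp [unrootWord]
    ext v
    simp only [Finset.mem_erase, Finset.mem_image]
    constructor
    · rintro ⟨h, w, hw, rfl⟩
      exact ⟨w, ⟨by rintro rfl; exact h this, hw⟩, rfl⟩
    · rintro ⟨w, ⟨h, hw⟩, rfl⟩
      exact ⟨fun h' => h (hinj hw hs.last_mem (h'.trans this.symm)), w, hw, rfl⟩
  rw [himg, Finset.prod_image (hinj.mono (by simp))]
  have m1 : [] ∈ s.erase [g [] - 1] := Finset.mem_erase.2 ⟨by simp, hs.nil_mem⟩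
  have m2 : [g [] - 1] ∈ s.erase [] := Finset.mem_erase.2 ⟨by simp, hs.last_mem⟩
  rw [← Finset.mul_prod_erase _ _ m1, ← Finset.mul_prod_erase _ _ m2, Finset.erase_right_comm]
  have hprod : ∏ w ∈ (s.erase []).erase [g [] - 1],
      p (unrootTree i g (unrootWord (g [] - 1) i w)) =
      ∏ w ∈ (s.erase []).erase [g [] - 1], p (g w) := by
    refine Finset.prod_congr rfl fun w hw => ?_
    simp only [Finset.mem_erase] at hw
    rw [unrootTree_unrootWord hs i hw.2.2 hw.2.1 hw.1]
  rw [hprod]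
  simp only [unrootTree, unrootWord]
  simp
  ring

lemma isValidNode_append_singleton {f : TreeCode} {w : List ℕ} {a : ℕ}
    (h : IsValidNode f (w ++ [a])) : a < f w := by
  simpa using h w.length (by simp)

/-- A Galton–Watson tree with offspring distribution `p` supported on
`{1, …, M}` (no leaves, hence no extinction), with the root's offspring law
modified to `P(c(o) = k + 1) = p_k`, is stationary: its distribution is
invariant under re-rooting at a uniformly random neighbour of the root.
The hypothesis `hGW` characterises the Galton–Watson law `μ` on tree codes:
for every finite subtree region `s` (containing the root and closed under
taking parents, with valid child indices for the assignment `g`), the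
probability that the children counts agree with `g` on `s` is the product of
`p (g [] − 1)` for the root and `p (g w)` over the other vertices of `s`. -/
theorem galtonWatson_size_biased_root_stationary
    (M : ℕ) (hM : 0 < M) (p : ℕ → ENNReal)
    (hp0 : p 0 = 0) (hpM : ∀ k, M < k → p k = 0)
    (hpsum : ∑ k ∈ Finset.range (M + 1), p k = 1)
    (μ : Measure TreeCode) [IsProbabilityMeasure μ]
    (hjunk : μ {f : TreeCode | ∀ w : List ℕ, ¬ IsValidNode f w → f w = 0} = 1)
    (hGW : ∀ (s : Finset (List ℕ)) (g : List ℕ → ℕ),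
      [] ∈ s →
      (∀ (w : List ℕ) (a : ℕ), w ++ [a] ∈ s → w ∈ s ∧ a < g w) →
      μ {f : TreeCode | ∀ w ∈ s, f w = g w} =
        p (g [] - 1) * ∏ w ∈ s.erase [], p (g w)) :
    μ.bind uniformReRoot = μ := by
  have hroot : μ {f : TreeCode | f [] = 0} = 0 := by
    have := hGW {[]} (fun _ => 0) (by simp) (by simp)
    simpa [hp0] using this
  have hproper : ∀ᵐ f ∂μ, f ∈ properTrees := by
    have hmeas : MeasurableSet {f : TreeCode | ∀ w : List ℕ, ¬ IsValidNode f w → f w = 0} := by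
      have hval : ∀ w, MeasurableSet {f : TreeCode | IsValidNode f w} := fun w => by
        simp only [IsValidNode, Set.ofPred_forall]
        exact MeasurableSet.iInter fun n => MeasurableSet.iInter fun h =>
          (measurable_pi_apply _) (measurableSet_Ioi (a := w.get ⟨n, h⟩))
      simp only [Set.ofPred_forall, imp_iff_not_or, not_not]
      exact MeasurableSet.iInter fun w =>
        (hval w).union ((measurable_pi_apply w) (measurableSet_singleton 0))
    have h1 : ∀ᵐ f ∂μ, ∀ w : List ℕ, ¬ IsValidNode f w → f w = 0 :=
      (mem_ae_iff_prob_eq_one hmeas).2 hjunk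
    have h2 : ∀ᵐ f ∂μ, f [] ≠ 0 := by
      rw [ae_iff]; simpa using hroot
    filter_upwards [h1, h2] with f hf h0
    refine ⟨h0, fun w a hw => isValidNode_append_singleton ?_⟩
    by_contra h
    exact hw (hf _ h)
  have hbind : ∀ {A : Set TreeCode}, MeasurableSet A →
      μ.bind uniformReRoot A = ∫⁻ f, uniformReRoot f A ∂μ := fun hA =>
    Measure.bind_apply hA measurable_uniformReRoot.aemeasurable
  refine (treeMeasure_ext hproper ?_ ?_ ?_).symm
  · rw [ae_iff]
    change μ.bind uniformReRoot properTreesᶜ = 0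
    rw [hbind measurableSet_properTrees.compl, ← lintegral_zero (μ := μ)]
    refine lintegral_congr_ae ?_
    filter_upwards [hproper] with f hf
    rw [uniformReRoot_apply f measurableSet_properTrees.compl, Finset.sum_eq_zero, mul_zero]
    intro i hi
    exact Set.indicator_of_notMem
      (not_not_intro (reRoot_mem_properTrees hf (Finset.mem_range.1 hi))) _
  · rw [hbind MeasurableSet.univ, ← lintegral_one]
    refine lintegral_congr_ae ?_
    filter_upwards [hproper] with f hf
    rw [uniformReRoot_apply f MeasurableSet.univ]
    simp [ENNReal.inv_mul_cancel (Nat.cast_ne_zero.2 hf.1) (ENNReal.natCast_ne_top _)]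
  · intro s g hs
    rw [hbind (measurableSet_treeCylinder s g)]
    simp_rw [uniformReRoot_treeCylinder hs]
    have hind : ∀ i, Measurable ((treeCylinder (s.image (unrootWord (g [] - 1) i))
        (unrootTree i g)).indicator (1 : TreeCode → ENNReal)) := fun i =>
      measurable_one.indicator (measurableSet_treeCylinder _ _)
    rw [lintegral_const_mul _ (Finset.measurable_sum _ fun i _ => hind i),
      lintegral_finsetSum _ fun i _ => hind i]
    have hterm : ∀ i ∈ Finset.range (g [g [] - 1] + 1),
        ∫⁻ f, (treeCylinder (s.image (unrootWord (g [] - 1) i)) (unrootTree i g)).indicator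
          1 f ∂μ = μ (treeCylinder s g) := by
      intro i hi
      rw [lintegral_indicator_one (measurableSet_treeCylinder _ _)]
      refine (hGW _ _ ?_ (hs.unroot_parent (Finset.mem_range.1 hi))).trans
        ((prod_unrootTree hs i p).trans (hGW s g hs.nil_mem hs.parent).symm)
      exact Finset.mem_image.2 ⟨_, hs.last_mem, by simp [unrootWord]⟩
    rw [Finset.sum_congr rfl hterm, Finset.sum_const, Finset.card_range, nsmul_eq_mul,
      ← mul_assoc, ENNReal.inv_mul_cancel (Nat.cast_ne_zero.2 (Nat.succ_ne_zero _))
        (ENNReal.natCast_ne_top _), one_mul]
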